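/- Consider a run of ONS over T rounds on the domain X, with d ≥ 1. Then for every u ∈ X, Σ_{t=1}^{T} (f_t(x_t) − f_t(u)) ≤ (d/(2γ₀))·log(1 + G²·T/(d·ε)) + γ₀·ε·D²/8, where γ₀ = (1/2)·min{1/(DG), α}. -/

import Mathlib

open scoped RealInnerProductSpace

noncomputable def mApp {d : ℕ} (A : Matrix (Fin d) (Fin d) ℝ) (x : EuclideanSpace ℝ (Fin d)) :
    EuclideanSpace ℝ (Fin d) :=
  Matrix.toEuclideanLin A x

noncomputable def quadForm {d : ℕ} (A : Matrix (Fin d) (Fin d) ℝ) (x : EuclideanSpace ℝ (Fin d)) : ℝ :=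
  ⟪x, mApp A x⟫

noncomputable def mnorm {d : ℕ} (A : Matrix (Fin d) (Fin d) ℝ) (x : EuclideanSpace ℝ (Fin d)) : ℝ :=
  Real.sqrt (quadForm A x)

/-- `p` is a Mahalanobis projection of `y` onto `C` with respect to `A`. -/
def IsMProj {d : ℕ} (A : Matrix (Fin d) (Fin d) ℝ) (C : Set (EuclideanSpace ℝ (Fin d)))
    (y p : EuclideanSpace ℝ (Fin d)) : Prop :=
  p ∈ C ∧ ∀ z ∈ C, mnorm A (p - y) ≤ mnorm A (z - y)

/-- The outer product `v vᵀ` of a vector with itself. -/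
noncomputable def outerProd {d : ℕ} (v : EuclideanSpace ℝ (Fin d)) : Matrix (Fin d) (Fin d) ℝ :=
  Matrix.of (fun i j => v i * v j)

section MahalanobisForm

variable {d : ℕ} {A : Matrix (Fin d) (Fin d) ℝ}

theorem inner_mApp (A : Matrix (Fin d) (Fin d) ℝ) (x y : EuclideanSpace ℝ (Fin d)) :
    ⟪x, mApp A y⟫ = x.ofLp ⬝ᵥ A.mulVec y.ofLp := by
  simp [mApp, EuclideanSpace.inner_eq_star_dotProduct, dotProduct_comm]

theorem inner_mApp_comm (hA : A.IsHermitian) (x y : EuclideanSpace ℝ (Fin d)) :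
    ⟪x, mApp A y⟫ = ⟪y, mApp A x⟫ := by
  have hT : A.transpose = A := by simpa using hA.eq
  rw [inner_mApp, inner_mApp, Matrix.dotProduct_mulVec, ← Matrix.mulVec_transpose, hT,
    dotProduct_comm]

theorem quadForm_add (hA : A.IsHermitian) (x y : EuclideanSpace ℝ (Fin d)) :
    quadForm A (x + y) = quadForm A x + 2 * ⟪x, mApp A y⟫ + quadForm A y := by
  have h := inner_mApp_comm hA y x
  simp only [quadForm, mApp, map_add, inner_add_left, inner_add_right] at h ⊢
  linarith

theorem quadForm_smul (A : Matrix (Fin d) (Fin d) ℝ) (c : ℝ) (x : EuclideanSpace ℝ (Fin d)) :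
    quadForm A (c • x) = c ^ 2 * quadForm A x := by
  simp only [quadForm, mApp, map_smul, real_inner_smul_left, real_inner_smul_right]
  ring

theorem quadForm_nonneg (hA : A.PosSemidef) (x : EuclideanSpace ℝ (Fin d)) :
    0 ≤ quadForm A x := by
  rw [quadForm, inner_mApp]
  simpa using hA.dotProduct_mulVec_nonneg x.ofLp

theorem quadForm_smul_one (c : ℝ) (x : EuclideanSpace ℝ (Fin d)) :
    quadForm (c • (1 : Matrix (Fin d) (Fin d) ℝ)) x = c * ‖x‖ ^ 2 := by
  rw [← real_inner_self_eq_norm_sq, quadForm, inner_mApp, Matrix.smul_mulVec, Matrix.one_mulVec,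
    dotProduct_smul, smul_eq_mul, EuclideanSpace.inner_eq_star_dotProduct, star_trivial]

theorem quadForm_add_outerProd (A : Matrix (Fin d) (Fin d) ℝ) (v x : EuclideanSpace ℝ (Fin d)) :
    quadForm (A + outerProd v) x = quadForm A x + ⟪v, x⟫ ^ 2 := by
  have h : outerProd v = Matrix.vecMulVec v.ofLp v.ofLp := rfl
  rw [quadForm, quadForm, inner_mApp, inner_mApp, Matrix.add_mulVec, dotProduct_add, h,
    Matrix.vecMulVec_mulVec, EuclideanSpace.inner_eq_star_dotProduct, star_trivial]
  simp [dotProduct_comm x.ofLp v.ofLp]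
  ring

theorem mApp_mApp_inv (hA : A.PosDef) (x : EuclideanSpace ℝ (Fin d)) :
    mApp A (mApp A⁻¹ x) = x := by
  have h : A * A⁻¹ = 1 := Matrix.mul_nonsing_inv A hA.det_pos.ne'.isUnit
  ext i
  simp [mApp, Matrix.mulVec_mulVec, h]

theorem posSemidef_outerProd (v : EuclideanSpace ℝ (Fin d)) : (outerProd v).PosSemidef := by
  have h := Matrix.posSemidef_vecMulVec_self_star v.ofLp
  rwa [star_trivial] at h

theorem trace_outerProd (v : EuclideanSpace ℝ (Fin d)) : (outerProd v).trace = ‖v‖ ^ 2 := by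
  rw [EuclideanSpace.real_norm_sq_eq]
  simp [outerProd, Matrix.trace, sq]

/-- The generalized Pythagorean inequality for Mahalanobis projections onto convex sets. -/
theorem IsMProj.quadForm_sub_le {C : Set (EuclideanSpace ℝ (Fin d))}
    {y p u : EuclideanSpace ℝ (Fin d)} (h : IsMProj A C y p) (hA : A.PosSemidef)
    (hC : Convex ℝ C) (hu : u ∈ C) : quadForm A (p - u) ≤ quadForm A (y - u) := by
  obtain ⟨hp, hmin⟩ := h
  set c := ⟪p - y, mApp A (u - p)⟫ with hc
  set q := quadForm A (u - p)
  have hq0 : 0 ≤ q := quadForm_nonneg hA _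
  have hline : ∀ s : ℝ, 0 ≤ s → s ≤ 1 → 0 ≤ 2 * s * c + s ^ 2 * q := by
    intro s hs0 hs1
    have h1 := hmin _ (hC.add_smul_sub_mem hp hu ⟨hs0, hs1⟩)
    rw [mnorm, mnorm, Real.sqrt_le_sqrt_iff (quadForm_nonneg hA _),
      show p + s • (u - p) - y = (p - y) + s • (u - p) by abel, quadForm_add hA.1,
      quadForm_smul] at h1
    simp only [mApp, map_smul, real_inner_smul_right] at h1 hc
    rw [← hc] at h1
    linarith
  have hc0 : 0 ≤ c := by
    by_contra! hneg
    have hden : 0 < q - c := by linarith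
    have h1 := hline (-c / (q - c)) (div_nonneg (by linarith) hden.le)
      ((div_le_one hden).2 (by linarith))
    have h2 : 2 * (-c / (q - c)) * c + (-c / (q - c)) ^ 2 * q
        = c ^ 2 * (2 * c - q) / (q - c) ^ 2 := by
      field_simp
      ring
    rw [h2] at h1
    have h3 : c ^ 2 * (2 * c - q) / (q - c) ^ 2 < 0 :=
      div_neg_of_neg_of_pos (mul_neg_of_pos_of_neg (sq_pos_of_neg hneg) (by linarith)) (by positivity)
    linarith
  have h1 : quadForm A (y - u) = quadForm A (y - p) + 2 * c + quadForm A (p - u) := by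
    rw [show y - u = (y - p) + (p - u) by abel, quadForm_add hA.1, hc, ← neg_sub y p,
      ← neg_sub p u, mApp, mApp, map_neg, inner_neg_neg]
  have h2 := quadForm_nonneg hA (y - p)
  linarith

/-- The squared distance bound for one Newton step followed by a Mahalanobis projection. -/
theorem IsMProj.inner_le_of_newton_step {C : Set (EuclideanSpace ℝ (Fin d))}
    {x p u v : EuclideanSpace ℝ (Fin d)} {γ : ℝ} (hγ : 0 < γ) (hA : A.PosDef)
    (h : IsMProj A C (x - (1 / γ) • mApp A⁻¹ v) p) (hC : Convex ℝ C) (hu : u ∈ C) :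
    ⟪v, x - u⟫ ≤ 1 / (2 * γ) * quadForm A⁻¹ v
      + γ / 2 * (quadForm A (x - u) - quadForm A (p - u)) := by
  have h1 := h.quadForm_sub_le hA.posSemidef hC hu
  rw [show x - (1 / γ) • mApp A⁻¹ v - u = (x - u) + (-(1 / γ)) • mApp A⁻¹ v by
    rw [neg_smul]; abel, quadForm_add hA.1, quadForm_smul] at h1
  have h2 : ⟪x - u, mApp A ((-(1 / γ)) • mApp A⁻¹ v)⟫ = -(1 / γ) * ⟪v, x - u⟫ := by
    have := mApp_mApp_inv hA v
    simp only [mApp] at this ⊢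
    rw [map_smul, this, real_inner_smul_right, real_inner_comm]
  have h3 : quadForm A (mApp A⁻¹ v) = quadForm A⁻¹ v := by
    rw [quadForm, mApp_mApp_inv hA, quadForm, real_inner_comm]
  rw [h2, h3] at h1
  have h4 := mul_le_mul_of_nonneg_left h1 (half_pos hγ).le
  have h5 : γ / 2 * (quadForm A (x - u) + 2 * (-(1 / γ) * ⟪v, x - u⟫)
      + (-(1 / γ)) ^ 2 * quadForm A⁻¹ v)
      = γ / 2 * quadForm A (x - u) - ⟪v, x - u⟫ + 1 / (2 * γ) * quadForm A⁻¹ v := by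
    field_simp
    ring
  linarith

/-- Each term of the elliptical potential is bounded by an increment of `log det`. -/
theorem quadForm_inv_le_log_det (hA : A.PosDef) (v : EuclideanSpace ℝ (Fin d)) :
    quadForm (A + outerProd v)⁻¹ v
      ≤ Real.log (A + outerProd v).det - Real.log A.det := by
  set B := A + outerProd v with hB
  have hBpos : B.PosDef := hA.add_posSemidef (posSemidef_outerProd v)
  have hdet : A.det = B.det * (1 - quadForm B⁻¹ v) := by
    have h1 : A = B + Matrix.replicateCol Unit (-v.ofLp) * Matrix.replicateRow Unit v.ofLp := by
      ext i j
      simp [hB, outerProd, Matrix.mul_apply]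
    have h2 : IsUnit B.det := hBpos.det_pos.ne'.isUnit
    rw [h1, Matrix.det_add_replicateCol_mul_replicateRow h2, quadForm, inner_mApp]
    congr 1
    simp [Matrix.mul_assoc, Matrix.det_unique, Matrix.mul_apply, dotProduct, Matrix.mulVec,
      Finset.mul_sum, sub_eq_add_neg]
  have hs : 0 < 1 - quadForm B⁻¹ v := by
    have := hA.det_pos
    rw [hdet] at this
    exact pos_of_mul_pos_right this hBpos.det_pos.le
  have h1 := Real.log_le_sub_one_of_pos hs
  rw [hdet, Real.log_mul hBpos.det_pos.ne' hs.ne']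
  linarith

/-- A logarithmic form of the inequality between the determinant and the trace. -/
theorem Matrix.PosDef.log_det_le_of_trace_le (hA : A.PosDef) {m : ℝ} (hm : 0 < m)
    (htr : A.trace ≤ d * m) : Real.log A.det ≤ d * Real.log m := by
  have hpos := hA.eigenvalues_pos
  have hdet : A.det = ∏ i, hA.1.eigenvalues i := by
    simpa using hA.1.det_eq_prod_eigenvalues
  have htrace : A.trace = ∑ i, hA.1.eigenvalues i := by
    simpa using hA.1.trace_eq_sum_eigenvalues
  rw [hdet, Real.log_prod fun i _ => (hpos i).ne']
  calc ∑ i, Real.log (hA.1.eigenvalues i)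
      ≤ ∑ i, (Real.log m + (hA.1.eigenvalues i / m - 1)) := by
        refine Finset.sum_le_sum fun i _ => ?_
        have := Real.log_le_sub_one_of_pos (div_pos (hpos i) hm)
        rw [Real.log_div (hpos i).ne' hm.ne'] at this
        linarith
    _ = d * Real.log m + (A.trace / m - d) := by
        rw [htrace, Finset.sum_add_distrib, Finset.sum_sub_distrib, ← Finset.sum_div]
        simp
    _ ≤ d * Real.log m := by
        have := (div_le_iff₀ hm).2 htr
        linarith

end MahalanobisForm

theorem Real.log_one_sub_le_neg_sub_sq {z : ℝ} (hz : -1 ≤ z) (hz' : z < 1) :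
    Real.log (1 - z) ≤ -z - z ^ 2 / 4 := by
  rcases le_total 0 z with h | h
  · have hs := hasSum_pow_div_log_of_abs_lt_one (abs_lt.2 ⟨by linarith, hz'⟩)
    have := sum_le_hasSum (Finset.range 2) (fun n _ => by positivity) hs
    norm_num [Finset.sum_range_succ] at this
    nlinarith [sq_nonneg z]
  · rw [Real.log_le_iff_le_exp (by linarith)]
    have h1 : 0 ≤ -z - z ^ 2 / 4 := by nlinarith
    have h2 := Real.quadratic_le_exp_of_nonneg h1
    have h3 : z ^ 2 / 4 ≤ (-z - z ^ 2 / 4) ^ 2 / 2 := by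
      have : (-z - z ^ 2 / 4) ^ 2 = z ^ 2 * (1 + z / 4) ^ 2 := by ring
      rw [this]
      nlinarith [sq_nonneg z, mul_nonneg (sq_nonneg z) (by nlinarith : 0 ≤ (1 + z / 4) ^ 2 - 1 / 2)]
    linarith

section ExpConcave

variable {E : Type*} [NormedAddCommGroup E] [InnerProductSpace ℝ E] [CompleteSpace E]
  {X : Set E} {f : E → ℝ} {v x u : E}

theorem ConcaveOn.le_add_inner_gradient (hf : ConcaveOn ℝ X f) (hv : HasGradientAt f v x)
    (hx : x ∈ X) (hu : u ∈ X) : f u ≤ f x + ⟪v, u - x⟫ := by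
  have hd : HasDerivAt (f ∘ AffineMap.lineMap (k := ℝ) x u) ⟪v, u - x⟫ 0 := by
    have h1 : HasFDerivAt f ((InnerProductSpace.toDual ℝ E) v)
        (AffineMap.lineMap (k := ℝ) x u 0) := by simpa using hv.hasFDerivAt
    simpa using h1.comp_hasDerivAt (0 : ℝ) AffineMap.hasDerivAt_lineMap
  have hc := hf.comp_affineMap (AffineMap.lineMap (k := ℝ) x u)
  have := hc.slope_le_of_hasDerivAt (x := 0) (y := 1) (by simpa) (by simpa) one_pos hd
  simp [slope] at this
  linarith

/-- An exp-concave function is bounded below by a quadratic model with curvature along the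
gradient. -/
theorem ConcaveOn.sub_le_inner_sub_sq {α γ : ℝ} (hα : 0 < α) (hγ : 0 < γ) (hγα : 2 * γ ≤ α)
    (hf : ConcaveOn ℝ X fun z => Real.exp (-α * f z)) (hv : HasGradientAt f v x)
    (hx : x ∈ X) (hu : u ∈ X) (hb : 2 * γ * |⟪v, x - u⟫| ≤ 1) :
    f x - f u ≤ ⟪v, x - u⟫ - γ / 2 * ⟪v, x - u⟫ ^ 2 := by
  set w := ⟪v, x - u⟫ with hw
  have hgrad : HasGradientAt (fun z => Real.exp (-α * f z))
      ((Real.exp (-α * f x) * -α) • v) x := by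
    have h1 := (hv.hasFDerivAt.const_mul (-α)).exp
    rw [hasGradientAt_iff_hasFDerivAt, map_smul, mul_smul]
    exact h1
  have h1 := hf.le_add_inner_gradient hgrad hx hu
  have h2 : ⟪v, u - x⟫ = -w := by rw [hw, ← neg_sub x u, inner_neg_right]
  simp only [real_inner_smul_left, h2] at h1
  have h3 : Real.exp (α * (f x - f u)) ≤ 1 + α * w := by
    rw [show α * (f x - f u) = -α * f u - -α * f x by ring, Real.exp_sub,
      div_le_iff₀ (Real.exp_pos _)]
    linarith
  have hp1 : 2 * γ / α ≤ 1 := (div_le_one hα).2 hγα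
  have h4 : Real.exp (2 * γ * (f x - f u)) ≤ 1 + 2 * γ * w := by
    calc Real.exp (2 * γ * (f x - f u)) = Real.exp (α * (f x - f u)) ^ (2 * γ / α) := by
          rw [← Real.exp_mul]
          congr 1
          field_simp
      _ ≤ (1 + α * w) ^ (2 * γ / α) :=
          Real.rpow_le_rpow (Real.exp_pos _).le h3 (by positivity)
      _ ≤ 1 + 2 * γ / α * (α * w) :=
          rpow_one_add_le_one_add_mul_self (by linarith [Real.exp_pos (α * (f x - f u))])
            (by positivity) hp1
      _ = 1 + 2 * γ * w := by field_simp
  have h5 : 0 < 1 + 2 * γ * w := (Real.exp_pos _).trans_le h4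
  have h6 : 2 * γ * (f x - f u) ≤ Real.log (1 - -(2 * γ * w)) := by
    rw [sub_neg_eq_add]
    exact (Real.le_log_iff_exp_le h5).2 h4
  have h7 : 2 * γ * w ≤ 1 := (mul_le_mul_of_nonneg_left (le_abs_self w) (by linarith)).trans hb
  have h8 := h6.trans (Real.log_one_sub_le_neg_sub_sq (by linarith) (by linarith))
  have h9 : 2 * γ * (f x - f u) ≤ 2 * γ * (w - γ / 2 * w ^ 2) := by linarith
  exact le_of_mul_le_mul_left h9 (by linarith)

end ExpConcave

/-- regret of Online Newton Step.
Rounds are indexed by `t ∈ {0, …, T-1}` (round `t+1` in the paper); the iterate `x t` is the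
paper's `x_{t+1}` and `A t` is the paper's `A_t`.  The initial decision `x 0 = 0` lies in the
domain `X` (the domain is centered at the origin). -/
theorem stmt_19 {d T : ℕ} (hd : 1 ≤ d)
    (X : Set (EuclideanSpace ℝ (Fin d))) (hne : X.Nonempty) (hcmp : IsCompact X)
    (hconv : Convex ℝ X) (hzero : (0 : EuclideanSpace ℝ (Fin d)) ∈ X)
    (D G α ε : ℝ) (hD : 0 < D) (hG : 0 < G) (hα : 0 < α) (hε : 0 < ε)
    (hdiam : ∀ x ∈ X, ∀ y ∈ X, ‖x - y‖ ≤ D)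
    (hXball : ∀ x ∈ X, ‖x‖ ≤ D / 2)
    (f : ℕ → EuclideanSpace ℝ (Fin d) → ℝ)
    (g : ℕ → EuclideanSpace ℝ (Fin d) → EuclideanSpace ℝ (Fin d))
    (hexp : ∀ t < T, ConcaveOn ℝ X (fun z => Real.exp (-α * f t z)))
    (hgrad : ∀ t < T, ∀ z ∈ X, HasGradientAt (f t) (g t z) z)
    (hgbound : ∀ t < T, ∀ z ∈ X, ‖g t z‖ ≤ G)
    (γ₀ : ℝ) (hγ₀ : γ₀ = (1/2) * min (1/(D*G)) α)
    (x xhat : ℕ → EuclideanSpace ℝ (Fin d)) (A : ℕ → Matrix (Fin d) (Fin d) ℝ)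
    (hx0 : x 0 = 0)
    (hA0 : A 0 = ε • (1 : Matrix (Fin d) (Fin d) ℝ))
    (hAstep : ∀ t < T, A (t+1) = A t + outerProd (g t (x t)))
    (hxhat : ∀ t < T, xhat (t+1) = x t - (1/γ₀) • mApp (A (t+1))⁻¹ (g t (x t)))
    (hproj : ∀ t < T, IsMProj (A (t+1)) X (xhat (t+1)) (x (t+1))) :
    ∀ u ∈ X, (∑ t ∈ Finset.range T, (f t (x t) - f t u))
      ≤ (d / (2*γ₀)) * Real.log (1 + G^2 * T / (d * ε)) + γ₀ * ε * D^2 / 8 := by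
  intro u hu
  have hγpos : 0 < γ₀ := by rw [hγ₀]; positivity
  have hγα : 2 * γ₀ ≤ α := by linarith [min_le_right (1 / (D * G)) α]
  have hγDG : 2 * γ₀ * (D * G) ≤ 1 := by
    have : 2 * γ₀ ≤ 1 / (D * G) := by linarith [min_le_left (1 / (D * G)) α]
    exact (le_div_iff₀ (by positivity)).1 this
  have hxX : ∀ t ≤ T, x t ∈ X := by
    rintro (_ | t) ht
    · exact hx0 ▸ hzero
    · exact (hproj t ht).1
  have hApos : ∀ t ≤ T, (A t).PosDef := by
    intro t
    induction t with
    | zero => exact fun _ => hA0 ▸ Matrix.PosDef.one.smul hε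
    | succ t ih =>
      intro ht
      rw [hAstep t ht]
      exact (ih (Nat.le_of_succ_le ht)).add_posSemidef (posSemidef_outerProd _)
  have htrace : ∀ t ≤ T, (A t).trace ≤ d * ε + t * G ^ 2 := by
    intro t
    induction t with
    | zero => intro _; simp [hA0, mul_comm]
    | succ t ih =>
      intro ht
      have h1 := pow_le_pow_left₀ (norm_nonneg _) (hgbound t ht (x t) (hxX t (Nat.le_of_succ_le ht))) 2
      have h2 := ih (Nat.le_of_succ_le ht)
      rw [hAstep t ht, Matrix.trace_add, trace_outerProd]
      push_cast
      linarith
  have hround : ∀ t < T, f t (x t) - f t u ≤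
      (1 / (2 * γ₀) * Real.log (A (t + 1)).det - γ₀ / 2 * quadForm (A (t + 1)) (x (t + 1) - u))
      - (1 / (2 * γ₀) * Real.log (A t).det - γ₀ / 2 * quadForm (A t) (x t - u)) := by
    intro t ht
    have hxt := hxX t ht.le
    have hinner : |⟪g t (x t), x t - u⟫| ≤ D * G := by
      rw [mul_comm]
      exact (abs_real_inner_le_norm _ _).trans
        (mul_le_mul (hgbound t ht _ hxt) (hdiam _ hxt _ hu) (norm_nonneg _) hG.le)
    have h1 := (hexp t ht).sub_le_inner_sub_sq hα hγpos hγα (hgrad t ht _ hxt) hxt hu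
      ((mul_le_mul_of_nonneg_left hinner (by linarith)).trans hγDG)
    have h2 := IsMProj.inner_le_of_newton_step hγpos (hApos (t + 1) ht)
      (hxhat t ht ▸ hproj t ht) hconv hu
    have h3 := mul_le_mul_of_nonneg_left
      (quadForm_inv_le_log_det (hApos t ht.le) (g t (x t)))
      (by positivity : 0 ≤ 1 / (2 * γ₀))
    have h4 := quadForm_add_outerProd (A t) (g t (x t)) (x t - u)
    rw [← hAstep t ht] at h3 h4
    rw [h4] at h2
    linarith
  have hsum := Finset.sum_le_sum fun t ht => hround t (Finset.mem_range.1 ht)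
  rw [Finset.sum_range_sub (fun t => 1 / (2 * γ₀) * Real.log (A t).det
    - γ₀ / 2 * quadForm (A t) (x t - u))] at hsum
  have hd0 : (0 : ℝ) < d := by exact_mod_cast hd
  have hfac : 0 < 1 + G ^ 2 * T / (d * ε) := by positivity
  have hlogT : Real.log (A T).det
      ≤ d * (Real.log ε + Real.log (1 + G ^ 2 * T / (d * ε))) := by
    rw [← Real.log_mul hε.ne' hfac.ne']
    refine (hApos T le_rfl).log_det_le_of_trace_le (by positivity)
      ((htrace T le_rfl).trans_eq ?_)
    field_simp
  have hlog0 : Real.log (A 0).det = d * Real.log ε := by simp [hA0]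
  have hq0 : quadForm (A 0) (x 0 - u) ≤ ε * (D / 2) ^ 2 := by
    rw [hA0, quadForm_smul_one, hx0, zero_sub, norm_neg]
    have := hXball u hu
    gcongr
  have hqT := quadForm_nonneg (hApos T le_rfl).posSemidef (x T - u)
  calc _ ≤ _ := hsum
    _ ≤ 1 / (2 * γ₀) * (d * (Real.log ε + Real.log (1 + G ^ 2 * T / (d * ε)))) - 0
        - (1 / (2 * γ₀) * (d * Real.log ε) - γ₀ / 2 * (ε * (D / 2) ^ 2)) := by
      rw [hlog0]
      gcongr
      positivity
    _ = _ := by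
      field_simp
      ring
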